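/- arXiv:1209.0081 — 2 statements merged into one kernel-verified Lean document; each statement's English description precedes it below -/
import Mathlib

section
/- Let K be a complete nonarchimedean normed field that is algebraically closed, and let a : ℕ → K be such that for every x ∈ K with ‖x‖ < 1 the series Σ_{n≥0} (n+1) · a_{n+1} · xⁿ is summable; define the derivative series g(x) = Σ'_{n≥0} ((n+1) : K) · a_{n+1} · xⁿ. Suppose there exist an integer n ≥ 2 and a real ρ with 0 < ρ < 1 such that ‖a₁‖ ≤ ‖(n : K) · aₙ‖ · ρ^{n-1}. Then there exists x ∈ K with ‖x‖ ≤ ρ and g(x) = 0. -/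
open Polynomial Filter Topology

theorem exists_last_max_norm {K : Type*} [NormedField K] {d : ℕ → K}
    (hd : Tendsto d atTop (𝓝 0)) (h0 : d 0 ≠ 0) {m : ℕ} (hm : m ≠ 0) (hdm : ‖d 0‖ ≤ ‖d m‖) :
    ∃ s, s ≠ 0 ∧ (∀ k, ‖d k‖ ≤ ‖d s‖) ∧ ∀ k, s < k → ‖d k‖ < ‖d s‖ := by
  have hfin : ∀ i, d i ≠ 0 → {k | ‖d i‖ ≤ ‖d k‖}.Finite := fun i hi => by
    have h := (hd.norm.eventually (gt_mem_nhds (by simpa using hi : ‖(0 : K)‖ < ‖d i‖)))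
    rw [← Nat.cofinite_eq_atTop, eventually_cofinite] at h
    simpa using h
  obtain ⟨i, hi, himax⟩ := Set.exists_max_image _ (fun k => ‖d k‖) (hfin 0 h0) ⟨m, hdm⟩
  have hmax : ∀ k, ‖d k‖ ≤ ‖d i‖ := fun k => by
    rcases le_total ‖d 0‖ ‖d k‖ with h | h
    · exact himax k h
    · exact h.trans hi
  have hi0 : d i ≠ 0 := norm_pos_iff.mp ((norm_pos_iff.mpr h0).trans_le hi)
  obtain ⟨s, hs, hslast⟩ := Set.exists_max_image _ id (hfin i hi0) ⟨i, le_refl ‖d i‖⟩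
  refine ⟨s, ?_, fun k => (hmax k).trans hs, fun k hk => ?_⟩
  · rintro rfl
    have := hslast m (le_trans hs hdm)
    simp only [id] at this
    omega
  · by_contra! h
    have := hslast k (le_trans hs h)
    simp only [id] at this
    omega

section Ultrametric

variable {K : Type*} [NormedField K] [IsUltrametricDist K]

theorem norm_coeff_mul_pow_le_of_forall_le_norm (c : K) {t : ℝ} (ht : 0 ≤ t) (S : Multiset K)
    (hS : ∀ x ∈ S, t ≤ ‖x‖) (s : ℕ) :
    ‖(C c * (S.map fun x => X - C x).prod).coeff s‖ * t ^ s ≤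
      ‖(C c * (S.map fun x => X - C x).prod).coeff 0‖ := by
  induction S using Multiset.induction_on generalizing s with
  | empty =>
    rcases s with _ | s
    · simp
    · simp [coeff_C]
  | cons x S ih =>
    have hx : t ≤ ‖x‖ := hS x (Multiset.mem_cons_self x S)
    have ih' := ih fun y hy => hS y (Multiset.mem_cons_of_mem hy)
    set R := C c * (S.map fun x => X - C x).prod with hR
    have hmul : C c * ((x ::ₘ S).map fun x => X - C x).prod = R * (X - C x) := by
      rw [Multiset.map_cons, Multiset.prod_cons, hR]; ring
    rw [hmul]
    rcases s with _ | s
    · simp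
    have h0 : ‖(R * (X - C x)).coeff 0‖ = ‖R.coeff 0‖ * ‖x‖ := by
      simp [mul_coeff_zero]
    rw [h0, coeff_mul_X_sub_C, sub_eq_add_neg]
    have hts : 0 ≤ t ^ (s + 1) := pow_nonneg ht _
    refine (mul_le_mul_of_nonneg_right (IsUltrametricDist.norm_add_le_max _ _) hts).trans ?_
    rw [max_mul_of_nonneg _ _ hts]
    refine max_le ?_ ?_
    · rw [pow_succ, ← mul_assoc]
      exact mul_le_mul (ih' s) hx ht (norm_nonneg _)
    · rw [norm_neg, norm_mul, mul_right_comm]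
      exact mul_le_mul_of_nonneg_right (ih' (s + 1)) (norm_nonneg _)

theorem exists_root_norm_coeff_mul_pow_le [IsAlgClosed K] {Q : K[X]} {s : ℕ} (hs : s ≠ 0)
    (hQ : Q.coeff s ≠ 0) :
    ∃ x, Q.eval x = 0 ∧ ‖Q.coeff s‖ * ‖x‖ ^ s ≤ ‖Q.coeff 0‖ := by
  classical
  have hsplit : Q.Splits := IsAlgClosed.splits Q
  have hQ0 : Q ≠ 0 := by rintro rfl; simp at hQ
  have hdeg : Q.natDegree ≠ 0 := by
    have := le_natDegree_of_ne_zero hQ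
    omega
  have hne : Q.roots.toFinset.Nonempty := by
    obtain ⟨x, hx⟩ := IsAlgClosed.exists_root Q
      (fun h => hdeg (natDegree_eq_of_degree_eq_some h))
    exact ⟨x, by simpa [hQ0] using hx⟩
  obtain ⟨x, hx, hmin⟩ := Finset.exists_min_image _ (fun x => ‖x‖) hne
  refine ⟨x, by simpa [hQ0] using hx, ?_⟩
  have h := norm_coeff_mul_pow_le_of_forall_le_norm Q.leadingCoeff (norm_nonneg x) Q.roots
    (fun y hy => hmin y (by simpa using hy)) s
  rwa [← hsplit.eq_prod_roots] at h

theorem norm_coeff_le_norm_taylor_coeff {P : K[X]} {s : ℕ}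
    (hP : ∀ k, s < k → ‖P.coeff k‖ < ‖P.coeff s‖) {y : K} (hy : ‖y‖ ≤ 1) :
    ‖P.coeff s‖ ≤ ‖(taylor y P).coeff s‖ := by
  rw [taylor_coeff, eval_eq_sum_range, Finset.sum_range_succ']
  simp only [hasseDeriv_coeff, zero_add, Nat.choose_self, Nat.cast_one, one_mul, pow_zero, mul_one]
  set f : ℕ → K := fun k => ((k + 1 + s).choose s : K) * P.coeff (k + 1 + s) * y ^ (k + 1)
  obtain ⟨k, hk⟩ := IsUltrametricDist.exists_norm_finsetSum_le
    (Finset.range (hasseDeriv s P).natDegree) f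
  set T := ∑ k ∈ Finset.range (hasseDeriv s P).natDegree, f k
  have hfk : ‖f k‖ ≤ ‖P.coeff (k + 1 + s)‖ := by
    simp only [f, norm_mul, norm_pow]
    calc _ ≤ 1 * ‖P.coeff (k + 1 + s)‖ * 1 := by
          gcongr
          · exact IsUltrametricDist.norm_natCast_le_one K _
          · exact pow_le_one₀ (norm_nonneg _) hy
      _ = _ := by ring
  have hT : ‖T‖ < ‖P.coeff s‖ := (hk.2.trans hfk).trans_lt (hP _ (by omega))
  by_contra! hlt
  have h := IsUltrametricDist.norm_add_le_max (T + P.coeff s) (-T)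
  rw [add_neg_cancel_comm, norm_neg] at h
  exact absurd h (not_le.mpr (max_lt hlt hT))

theorem exists_root_near [IsAlgClosed K] {P : K[X]} {s : ℕ} (hs : s ≠ 0)
    (hP : ∀ k, s < k → ‖P.coeff k‖ < ‖P.coeff s‖) {y : K} (hy : ‖y‖ ≤ 1) :
    ∃ x, P.eval x = 0 ∧ ‖P.coeff s‖ * ‖x - y‖ ^ s ≤ ‖P.eval y‖ := by
  have hle := norm_coeff_le_norm_taylor_coeff hP hy
  have hpos : 0 < ‖P.coeff s‖ := (norm_nonneg _).trans_lt (hP (s + 1) (Nat.lt_succ_self s))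
  obtain ⟨x, hx, hxs⟩ := exists_root_norm_coeff_mul_pow_le hs (norm_pos_iff.mp (hpos.trans_le hle))
  refine ⟨x + y, by rwa [taylor_eval] at hx, ?_⟩
  rw [taylor_coeff_zero] at hxs
  rw [add_sub_cancel_right]
  exact (mul_le_mul_of_nonneg_right hle (by positivity)).trans hxs

theorem norm_pow_sub_pow_le {x y : K} (hx : ‖x‖ ≤ 1) (hy : ‖y‖ ≤ 1) (k : ℕ) :
    ‖x ^ k - y ^ k‖ ≤ ‖x - y‖ := by
  rw [← geom_sum₂_mul, norm_mul]
  refine mul_le_of_le_one_left (norm_nonneg _)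
    (IsUltrametricDist.norm_sum_le_of_forall_le_of_nonneg zero_le_one fun i _ => ?_)
  rw [norm_mul, norm_pow, norm_pow]
  exact mul_le_one₀ (pow_le_one₀ (norm_nonneg _) hx) (by positivity)
    (pow_le_one₀ (norm_nonneg _) hy)

/-- A power series convergent on the closed unit disk, whose constant term is nonzero and dominated
by some later coefficient, has a zero in the closed unit disk. -/
theorem exists_tendsto_sum_zero_of_norm_le [CompleteSpace K] [IsAlgClosed K] {d : ℕ → K}
    (hd : Tendsto d atTop (𝓝 0)) (h0 : d 0 ≠ 0) {m : ℕ} (hm : m ≠ 0) (hdm : ‖d 0‖ ≤ ‖d m‖) :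
    ∃ y : K, ‖y‖ ≤ 1 ∧
      Tendsto (fun N => ∑ k ∈ Finset.range N, d k * y ^ k) atTop (𝓝 0) := by
  obtain ⟨s, hs, hmax, hlast⟩ := exists_last_max_norm hd h0 hm hdm
  have hpos : 0 < ‖d s‖ := (norm_pos_iff.mpr h0).trans_le (hmax 0)
  let p : ℕ → K → K := fun N x => ∑ k ∈ Finset.range (N + (s + 1)), d k * x ^ k
  have hroot : ∀ N y, ∃ x, ‖y‖ ≤ 1 → p N x = 0 ∧ ‖d s‖ * ‖x - y‖ ^ s ≤ ‖p N y‖ := by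
    intro N y
    by_cases hy : ‖y‖ ≤ 1
    swap
    · exact ⟨0, fun h => absurd h hy⟩
    let P : K[X] := ∑ k ∈ Finset.range (N + (s + 1)), C (d k) * X ^ k
    have hev : ∀ x, P.eval x = p N x := fun x => by simp [P, p, eval_finsetSum]
    have hcoeff : ∀ k, P.coeff k = if k < N + (s + 1) then d k else 0 := fun k => by
      simp [P, coeff_X_pow]
    have hPs : P.coeff s = d s := by rw [hcoeff, if_pos (by omega)]
    obtain ⟨x, hx, hxy⟩ := exists_root_near (P := P) hs (fun k hk => by
      rw [hPs, hcoeff]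
      split_ifs
      · exact hlast k hk
      · simpa using hpos) hy
    rw [hev] at hx
    rw [hev, hPs] at hxy
    exact ⟨x, fun _ => ⟨hx, hxy⟩⟩
  choose F hF using hroot
  have hball : ∀ {x y : K} {e : ℝ}, ‖y‖ ≤ 1 → e ≤ ‖d s‖ → ‖d s‖ * ‖x - y‖ ^ s ≤ e → ‖x‖ ≤ 1 := by
    intro x y e hy he h
    have h1 : ‖x - y‖ ^ s ≤ 1 := by
      have := h.trans he
      rwa [mul_le_iff_le_one_right hpos] at this
    have h2 : ‖x - y‖ ≤ 1 := (pow_le_one_iff_of_nonneg (norm_nonneg _) hs).mp h1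
    simpa using (IsUltrametricDist.norm_add_le_max (x - y) y).trans (max_le h2 hy)
  let u : ℕ → K := fun N => Nat.rec (F 0 0) (fun N y => F (N + 1) y) N
  have hstep : ∀ N, ‖u N‖ ≤ 1 → p N (u N) = 0 → ‖p (N + 1) (u N)‖ ≤ ‖d (N + (s + 1))‖ := by
    intro N h1 h2
    have : p (N + 1) (u N) = p N (u N) + d (N + (s + 1)) * u N ^ (N + (s + 1)) := by
      simp only [p]
      rw [show N + 1 + (s + 1) = N + (s + 1) + 1 by ring, Finset.sum_range_succ]
    rw [this, h2, zero_add, norm_mul, norm_pow]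
    exact mul_le_of_le_one_right (norm_nonneg _) (pow_le_one₀ (norm_nonneg _) h1)
  have hu : ∀ N, ‖u N‖ ≤ 1 ∧ p N (u N) = 0 := by
    intro N
    induction N with
    | zero =>
      have h := hF 0 0 (by simp)
      have hp : p 0 0 = d 0 := by
        simp only [p]
        rw [Finset.sum_eq_single_of_mem 0 (by simp) (fun k _ hk => by simp [hk])]
        simp
      exact ⟨hball (y := 0) (by simp) (by rw [hp]; exact hmax 0) h.2, h.1⟩
    | succ N ih =>
      have h := hF (N + 1) (u N) ih.1
      exact ⟨hball ih.1 ((hstep N ih.1 ih.2).trans (hmax _)) h.2, h.1⟩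
  have hdiff : ∀ N, ‖d s‖ * ‖u (N + 1) - u N‖ ^ s ≤ ‖d (N + (s + 1))‖ := fun N =>
    (hF (N + 1) (u N) (hu N).1).2.trans (hstep N (hu N).1 (hu N).2)
  have hlim : Tendsto (fun N => u (N + 1) - u N) atTop (𝓝 0) := by
    rw [Metric.tendsto_atTop]
    intro ε hε
    have hd' := (tendsto_add_atTop_iff_nat (s + 1)).mpr hd
    obtain ⟨N₀, hN₀⟩ := Metric.tendsto_atTop.mp hd' (‖d s‖ * ε ^ s) (by positivity)
    refine ⟨N₀, fun N hN => ?_⟩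
    have h := hN₀ N hN
    rw [dist_zero_right] at h ⊢
    exact lt_of_pow_lt_pow_left₀ s hε.le
      (lt_of_mul_lt_mul_left ((hdiff N).trans_lt h) hpos.le)
  obtain ⟨y, hy⟩ := cauchySeq_tendsto_of_complete
    (NonarchimedeanAddGroup.cauchySeq_of_tendsto_sub_nhds_zero hlim)
  have hy1 : ‖y‖ ≤ 1 := le_of_tendsto hy.norm (Eventually.of_forall fun N => (hu N).1)
  refine ⟨y, hy1, (tendsto_add_atTop_iff_nat (s + 1)).mp ?_⟩
  refine squeeze_zero_norm (a := fun N => ‖d s‖ * ‖y - u N‖) (fun N => ?_) ?_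
  · have : p N y = ∑ k ∈ Finset.range (N + (s + 1)), d k * (y ^ k - u N ^ k) := by
      rw [← sub_zero (p N y), ← (hu N).2]
      simp only [p, ← Finset.sum_sub_distrib, mul_sub]
    change ‖p N y‖ ≤ _
    rw [this]
    refine IsUltrametricDist.norm_sum_le_of_forall_le_of_nonneg (by positivity) fun k _ => ?_
    rw [norm_mul]
    exact mul_le_mul (hmax k) (norm_pow_sub_pow_le hy1 (hu N).1 k) (norm_nonneg _) hpos.le
  · simpa using (hy.const_sub y).norm.const_mul ‖d s‖

end Ultrametric


/-- **Condition (1), converse direction.** Over a complete algebraically closed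
nonarchimedean field, failure of the étale coefficient bound at radius `ρ` forces a zero
of the formal derivative `g(x) = ∑ (n+1)·a_{n+1}·xⁿ` in the closed disk of radius `ρ`. -/
theorem stmt_7 {K : Type*} [NormedField K] [IsUltrametricDist K] [CompleteSpace K]
    [IsAlgClosed K]
    (a : ℕ → K)
    (hconv : ∀ x : K, ‖x‖ < 1 → Summable (fun n : ℕ => ((n + 1 : ℕ) : K) * a (n + 1) * x ^ n))
    (g : K → K) (hg : ∀ x : K, g x = ∑' n : ℕ, ((n + 1 : ℕ) : K) * a (n + 1) * x ^ n)
    (n : ℕ) (hn : 2 ≤ n) (ρ : ℝ) (hρ0 : 0 < ρ) (hρ1 : ρ < 1)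
    (hfail : ‖a 1‖ ≤ ‖(n : K) * a n‖ * ρ ^ (n - 1)) :
    ∃ x : K, ‖x‖ ≤ ρ ∧ g x = 0 := by
  obtain ⟨m, rfl⟩ : ∃ m, n = m + 1 := ⟨n - 1, by omega⟩
  have hm : m ≠ 0 := by omega
  rw [Nat.add_sub_cancel] at hfail
  set b : ℕ → K := fun k => ((k + 1 : ℕ) : K) * a (k + 1) with hb
  have hb0 : b 0 = a 1 := by simp [hb]
  by_cases ha : a 1 = 0
  · refine ⟨0, by simpa using hρ0.le, ?_⟩
    rw [hg, tsum_eq_single 0 (fun k hk => by simp [hk])]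
    simp [ha]
  have hbm : 0 < ‖b m‖ :=
    pos_of_mul_pos_left ((norm_pos_iff.mpr ha).trans_le hfail) (pow_nonneg hρ0.le m)
  obtain ⟨c, hc⟩ := IsAlgClosed.exists_pow_nat_eq (b 0 / b m) (Nat.pos_of_ne_zero hm)
  have hcρ : ‖c‖ ≤ ρ := by
    refine le_of_pow_le_pow_left₀ hm hρ0.le ?_
    rw [← norm_pow, hc, norm_div, div_le_iff₀ hbm, hb0, mul_comm]
    exact hfail
  obtain ⟨y, hy1, hy⟩ := exists_tendsto_sum_zero_of_norm_le (d := fun k => b k * c ^ k) (m := m)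
    (hconv c (hcρ.trans_lt hρ1)).tendsto_atTop_zero (by simpa [hb0] using ha) hm
    (by
      rw [hc, mul_div_cancel₀ _ (norm_pos_iff.mp hbm)]
      simp)
  have hcy : ‖c * y‖ ≤ ρ := by
    rw [norm_mul]
    exact (mul_le_of_le_one_right (norm_nonneg _) hy1).trans hcρ
  refine ⟨c * y, hcy, ?_⟩
  rw [hg]
  refine tendsto_nhds_unique (hconv _ (hcy.trans_lt hρ1)).hasSum.tendsto_sum_nat ?_
  simpa only [hb, mul_pow, mul_assoc] using hy
end

section
/- Let K be a complete nonarchimedean normed field with ‖(p : K)‖ = (p : ℝ)⁻¹ for a prime p, let ρ be a real number with 0 < ρ < 1, and let a : ℕ → K be such that for every x ∈ K with ‖x‖ < 1 the series Σ_{n≥0} aₙ xⁿ is summable; define f(x) = Σ'_{n≥0} aₙ xⁿ. If for every integer n ≥ 2 one has ‖a₁‖ > ‖(n : K) · aₙ‖ · ρ^{n-1}, then for all x, y ∈ K with ‖x‖ < ρ · (p : ℝ)^{-1/(p-1)} and ‖y‖ < ρ · (p : ℝ)^{-1/(p-1)}, f(x) = f(y) implies x = y. -/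
/-- If `‖p‖ = p⁻¹`, an integer prime to `p` has norm one. -/
lemma norm_natCast_eq_one_of_coprime {K : Type*} [NormedField K] [IsUltrametricDist K]
    {p m : ℕ} (hp : ‖(p : K)‖ < 1) (hm : p.Coprime m) : ‖(m : K)‖ = 1 := by
  refine le_antisymm (IsUltrametricDist.norm_natCast_le_one K m) ?_
  by_contra! h
  have hbez : (1 : K) = p * (p.gcdA m : K) + m * (p.gcdB m : K) := by
    have := congrArg (Int.cast : ℤ → K) (Nat.gcd_eq_gcd_ab p m)
    rw [Nat.Coprime.gcd_eq_one hm] at this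
    push_cast at this
    exact this
  have hmul : ∀ (x : K) (z : ℤ), ‖x‖ < 1 → ‖x * z‖ < 1 := fun x z hx ↦ by
    rw [norm_mul]
    exact (mul_le_of_le_one_right (norm_nonneg x)
      (IsUltrametricDist.norm_intCast_le_one K z)).trans_lt hx
  have hlt : ‖(1 : K)‖ < 1 := by
    rw [hbez]
    exact (IsUltrametricDist.norm_add_le_max _ _).trans_lt
      (max_lt (hmul _ _ hp) (hmul _ _ h))
  simp at hlt

/-- Powers of `u ≤ 1` with `u ^ (p - 1) = ‖p‖ = p⁻¹` bound the norms of integers from below. -/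
lemma pow_pred_le_norm_natCast {K : Type*} [NormedField K] [IsUltrametricDist K]
    {p : ℕ} (hp : p.Prime) (hpK : ‖(p : K)‖ = (p : ℝ)⁻¹) {u : ℝ} (hu0 : 0 ≤ u) (hu1 : u ≤ 1)
    (hu : u ^ (p - 1) = (p : ℝ)⁻¹) {n : ℕ} (hn : n ≠ 0) : u ^ (n - 1) ≤ ‖(n : K)‖ := by
  obtain ⟨v, m, hpm, rfl⟩ := Nat.exists_eq_pow_mul_and_not_dvd hn p hp.ne_one
  have hp1 : ‖(p : K)‖ < 1 := by
    rw [hpK]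
    exact inv_lt_one_of_one_lt₀ (by exact_mod_cast hp.one_lt)
  have hm : m ≠ 0 := right_ne_zero_of_mul hn
  rw [Nat.cast_mul, Nat.cast_pow, norm_mul, norm_pow,
    norm_natCast_eq_one_of_coprime hp1 ((hp.coprime_iff_not_dvd).2 hpm), mul_one, hpK, ← hu,
    ← pow_mul]
  refine pow_le_pow_of_le_one hu0 hu1 ?_
  have hbern : (1 : ℤ) + v * ((p : ℤ) - 1) ≤ (p : ℤ) ^ v := by
    have := one_add_mul_le_pow (a := (p : ℤ) - 1) (by have := hp.two_le; lia) v
    rwa [add_sub_cancel] at this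
  have hle : p ^ v ≤ p ^ v * m := Nat.le_mul_of_pos_right _ (Nat.pos_of_ne_zero hm)
  have hp1 := hp.one_le
  zify [hp1, Nat.one_le_iff_ne_zero.2 hn] at hle ⊢
  linarith

/-- An ultrametric Lipschitz estimate for `x ↦ x ^ n`. -/
lemma norm_pow_sub_pow_le_of_isUltrametricDist {K : Type*} [NormedField K] [IsUltrametricDist K]
    {x y : K} {s : ℝ} (hx : ‖x‖ ≤ s) (hy : ‖y‖ ≤ s) (n : ℕ) :
    ‖x ^ n - y ^ n‖ ≤ s ^ (n - 1) * ‖x - y‖ := by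
  have hs : 0 ≤ s := (norm_nonneg x).trans hx
  rw [← (Commute.all x y).geom_sum₂_mul n, norm_mul]
  gcongr
  refine IsUltrametricDist.norm_sum_le_of_forall_le_of_nonneg (pow_nonneg hs _) fun i hi ↦ ?_
  have hin : n - 1 = i + (n - 1 - i) := by
    have := Finset.mem_range.1 hi
    lia
  rw [norm_mul, norm_pow, norm_pow, hin, pow_add, ← hin]
  gcongr

/-- **Single-radius form of the p-adic Rolle theorem.** The étale coefficient bound at a
single radius `ρ` already yields injectivity of the power series `f` on the open disk of
radius `ρ·p^(-1/(p-1))` around `0`. -/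
theorem stmt_17 {K : Type*} [NormedField K] [IsUltrametricDist K] [CompleteSpace K]
    (p : ℕ) (hp : p.Prime) (hpK : ‖(p : K)‖ = (p : ℝ)⁻¹)
    (ρ : ℝ) (hρ0 : 0 < ρ) (hρ1 : ρ < 1) (a : ℕ → K)
    (hconv : ∀ x : K, ‖x‖ < 1 → Summable (fun n : ℕ => a n * x ^ n))
    (f : K → K) (hf : ∀ x : K, f x = ∑' n : ℕ, a n * x ^ n)
    (hetale : ∀ n : ℕ, 2 ≤ n → ‖a 1‖ > ‖(n : K) * a n‖ * ρ ^ (n - 1)) :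
    ∀ x y : K, ‖x‖ < ρ * (p : ℝ) ^ (-1 / ((p : ℝ) - 1)) →
      ‖y‖ < ρ * (p : ℝ) ^ (-1 / ((p : ℝ) - 1)) → f x = f y → x = y := by
  intro x y hx hy hxy
  set u : ℝ := (p : ℝ) ^ (-1 / ((p : ℝ) - 1)) with hu_def
  have hp1 : (1 : ℝ) < p := by exact_mod_cast hp.one_lt
  have hu0 : 0 < u := Real.rpow_pos_of_pos (by linarith) _
  have hu1 : u ≤ 1 := Real.rpow_le_one_of_one_le_of_nonpos hp1.le
    (div_nonpos_of_nonpos_of_nonneg (by norm_num) (by linarith))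
  have hu : u ^ (p - 1) = (p : ℝ)⁻¹ := by
    rw [hu_def, ← Real.rpow_natCast, ← Real.rpow_mul (by linarith), Nat.cast_sub hp.one_le,
      Nat.cast_one, div_mul_cancel₀ _ (by linarith), Real.rpow_neg_one]
  have hr : 0 < ρ * u := mul_pos hρ0 hu0
  have hr1 : ρ * u < 1 := (mul_le_of_le_one_right hρ0.le hu1).trans_lt hρ1
  have ha1 : 0 < ‖a 1‖ := lt_of_le_of_lt (by positivity) (hetale 2 le_rfl)
  obtain ⟨t, ht0, ht1, htx, hty⟩ :
      ∃ t : ℝ, 0 ≤ t ∧ t < 1 ∧ ‖x‖ ≤ ρ * u * t ∧ ‖y‖ ≤ ρ * u * t := by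
    refine ⟨max ‖x‖ ‖y‖ / (ρ * u), by positivity, (div_lt_one hr).2 (max_lt hx hy), ?_, ?_⟩ <;>
      rw [mul_div_cancel₀ _ hr.ne']
    exacts [le_max_left _ _, le_max_right _ _]
  have hcoeff : ∀ n, 2 ≤ n → ‖a n‖ * (ρ * u * t) ^ (n - 1) ≤ ‖a 1‖ * t := fun n hn ↦
    calc ‖a n‖ * (ρ * u * t) ^ (n - 1)
        = u ^ (n - 1) * ‖a n‖ * ρ ^ (n - 1) * t ^ (n - 1) := by
          rw [mul_pow, mul_pow]; ring
      _ ≤ ‖(n : K)‖ * ‖a n‖ * ρ ^ (n - 1) * t := by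
          gcongr
          · exact pow_pred_le_norm_natCast hp hpK hu0.le hu1 hu (by lia)
          · exact pow_le_of_le_one ht0 ht1.le (by lia)
      _ ≤ ‖a 1‖ * t := by
          gcongr
          rw [← norm_mul]
          exact (hetale n hn).le
  have hsx := hconv x (hx.trans hr1)
  have hsy := hconv y (hy.trans hr1)
  have hsum := hsx.sub hsy
  have htsum : ∑' n, (a n * x ^ n - a n * y ^ n) = 0 := by
    rw [hsx.tsum_sub hsy, ← hf, ← hf, hxy, sub_self]
  have hlin : a 1 * (x - y) = -∑' n, (a (n + 2) * x ^ (n + 2) - a (n + 2) * y ^ (n + 2)) := by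
    rw [← hsum.sum_add_tsum_nat_add 2] at htsum
    simp only [Finset.sum_range_succ, Finset.sum_range_zero, pow_zero, pow_one] at htsum
    linear_combination htsum
  have hbound : ‖a 1 * (x - y)‖ ≤ ‖a 1‖ * t * ‖x - y‖ := by
    rw [hlin, norm_neg]
    refine IsUltrametricDist.norm_tsum_le_of_forall_le_of_nonneg (by positivity) fun n ↦ ?_
    rw [← mul_sub, norm_mul]
    calc ‖a (n + 2)‖ * ‖x ^ (n + 2) - y ^ (n + 2)‖
        ≤ ‖a (n + 2)‖ * ((ρ * u * t) ^ (n + 2 - 1) * ‖x - y‖) := by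
          gcongr
          exact norm_pow_sub_pow_le_of_isUltrametricDist htx hty _
      _ ≤ ‖a 1‖ * t * ‖x - y‖ := by
          rw [← mul_assoc]
          exact mul_le_mul_of_nonneg_right (hcoeff (n + 2) (Nat.le_add_left 2 n)) (norm_nonneg _)
  by_contra hne
  have hpos : 0 < ‖a 1‖ * ‖x - y‖ := mul_pos ha1 (norm_pos_iff.2 (sub_ne_zero.2 hne))
  rw [norm_mul] at hbound
  nlinarith
end
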